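/- arXiv:1807.05899 — 3 statements merged into one kernel-verified Lean document; each statement's English description precedes it below -/
import Mathlib

section
/- With 𝒰, F and the induced slice-regular function f as in the context: for every x, y ∈ ℝ with x + ιy ∈ 𝒰, there exists v ∈ 𝕊 such that f(x + v y) = 0 if and only if Φ(F(x + ιy)) = 0. -/
noncomputable section
open Complex MeasureTheory

/-- The quaternion `i`. -/
def qi : Quaternion ℝ := ⟨0,1,0,0⟩
/-- The quaternion `j`. -/
def qj : Quaternion ℝ := ⟨0,0,1,0⟩
/-- The quaternion `k`. -/
def qk : Quaternion ℝ := ⟨0,0,0,1⟩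

/-- `ρ_v : ℂ → ℍ`, `x + ιy ↦ x + vy`. -/
def rhoC (v : Quaternion ℝ) (z : ℂ) : Quaternion ℝ := (z.re : Quaternion ℝ) + z.im • v

/-- `ρ_v : ℂ⁴ → ℍ`, `(z₀,z₁,z₂,z₃) ↦ ρ_v(z₀) + ρ_v(z₁)i + ρ_v(z₂)j + ρ_v(z₃)k`. -/
def rho4 (v : Quaternion ℝ) (z : Fin 4 → ℂ) : Quaternion ℝ :=
  rhoC v (z 0) + rhoC v (z 1) * qi + rhoC v (z 2) * qj + rhoC v (z 3) * qk

/-- The quadratic form `Φ(z) = z₀² + z₁² + z₂² + z₃²`. -/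
def Phi (z : Fin 4 → ℂ) : ℂ := z 0 ^ 2 + z 1 ^ 2 + z 2 ^ 2 + z 3 ^ 2

/-- The quaternion whose components are the real parts of the components of `z`. -/
def quaternionRe (z : Fin 4 → ℂ) : Quaternion ℝ := ⟨(z 0).re, (z 1).re, (z 2).re, (z 3).re⟩

/-- The quaternion whose components are the imaginary parts of the components of `z`. -/
def quaternionIm (z : Fin 4 → ℂ) : Quaternion ℝ := ⟨(z 0).im, (z 1).im, (z 2).im, (z 3).im⟩

@[simp] theorem re_quaternionRe (z : Fin 4 → ℂ) : (quaternionRe z).re = (z 0).re := rfl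
@[simp] theorem imI_quaternionRe (z : Fin 4 → ℂ) : (quaternionRe z).imI = (z 1).re := rfl
@[simp] theorem imJ_quaternionRe (z : Fin 4 → ℂ) : (quaternionRe z).imJ = (z 2).re := rfl
@[simp] theorem imK_quaternionRe (z : Fin 4 → ℂ) : (quaternionRe z).imK = (z 3).re := rfl
@[simp] theorem re_quaternionIm (z : Fin 4 → ℂ) : (quaternionIm z).re = (z 0).im := rfl
@[simp] theorem imI_quaternionIm (z : Fin 4 → ℂ) : (quaternionIm z).imI = (z 1).im := rfl
@[simp] theorem imJ_quaternionIm (z : Fin 4 → ℂ) : (quaternionIm z).imJ = (z 2).im := rfl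
@[simp] theorem imK_quaternionIm (z : Fin 4 → ℂ) : (quaternionIm z).imK = (z 3).im := rfl

@[simp] theorem re_qi : qi.re = 0 := rfl
@[simp] theorem re_qj : qj.re = 0 := rfl
@[simp] theorem re_qk : qk.re = 0 := rfl
@[simp] theorem imI_qi : qi.imI = 1 := rfl
@[simp] theorem imI_qj : qj.imI = 0 := rfl
@[simp] theorem imI_qk : qk.imI = 0 := rfl
@[simp] theorem imJ_qi : qi.imJ = 0 := rfl
@[simp] theorem imJ_qj : qj.imJ = 1 := rfl
@[simp] theorem imJ_qk : qk.imJ = 0 := rfl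
@[simp] theorem imK_qi : qi.imK = 0 := rfl
@[simp] theorem imK_qj : qj.imK = 0 := rfl
@[simp] theorem imK_qk : qk.imK = 1 := rfl

theorem quaternion_sq_eq_neg_one_iff (v : Quaternion ℝ) :
    v ^ 2 = -1 ↔ v.re = 0 ∧ Quaternion.normSq v = 1 := by
  rw [sq, Quaternion.ext_iff, Quaternion.normSq_def']
  simp only [Quaternion.re_mul, Quaternion.imI_mul, Quaternion.imJ_mul, Quaternion.imK_mul,
    Quaternion.re_neg, Quaternion.imI_neg, Quaternion.imJ_neg, Quaternion.imK_neg,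
    Quaternion.re_one, Quaternion.imI_one, Quaternion.imJ_one, Quaternion.imK_one]
  constructor
  · rintro ⟨h0, h1, h2, h3⟩
    have hre : v.re = 0 := by
      by_contra hne
      have e1 : v.imI = 0 := by
        apply mul_left_cancel₀ hne; linarith
      have e2 : v.imJ = 0 := by
        apply mul_left_cancel₀ hne; linarith
      have e3 : v.imK = 0 := by
        apply mul_left_cancel₀ hne; linarith
      rw [e1, e2, e3] at h0
      nlinarith [mul_self_nonneg v.re]
    refine ⟨hre, ?_⟩
    rw [hre] at h0 ⊢
    linarith
  · rintro ⟨hre, h⟩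
    rw [hre] at h ⊢
    refine ⟨?_, ?_, ?_, ?_⟩ <;> linarith

theorem exists_imaginary_unit_add_mul_eq_zero_iff (a b : Quaternion ℝ) :
    (∃ v : Quaternion ℝ, v ^ 2 = -1 ∧ a + v * b = 0) ↔
      Quaternion.normSq a = Quaternion.normSq b ∧ (a * star b).re = 0 := by
  constructor
  · rintro ⟨v, hv, h⟩
    obtain ⟨hre, hn⟩ := (quaternion_sq_eq_neg_one_iff v).1 hv
    obtain rfl : a = -(v * b) := eq_neg_of_add_eq_zero_left h
    refine ⟨by rw [Quaternion.normSq_neg, map_mul, hn, one_mul], ?_⟩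
    rw [neg_mul, mul_assoc, Quaternion.self_mul_star]
    simp [hre]
  · rintro ⟨hn, hre⟩
    by_cases hb : b = 0
    · subst hb
      have ha : a = 0 := by simpa using hn
      refine ⟨qi, (quaternion_sq_eq_neg_one_iff qi).2 ⟨rfl, ?_⟩, by simp [ha]⟩
      simp [Quaternion.normSq_def']
    · have hb' : Quaternion.normSq b ≠ 0 := Quaternion.normSq_ne_zero.2 hb
      refine ⟨-(a * b⁻¹), (quaternion_sq_eq_neg_one_iff _).2 ⟨?_, ?_⟩, ?_⟩
      · rw [Quaternion.inv_def, mul_smul_comm, Quaternion.re_neg, Quaternion.re_smul, hre]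
        simp
      · rw [Quaternion.normSq_neg, map_mul, map_inv₀, hn, mul_inv_cancel₀ hb']
      · rw [neg_mul, inv_mul_cancel_right₀ hb, add_neg_cancel]

theorem rho4_eq_add_mul (v : Quaternion ℝ) (z : Fin 4 → ℂ) :
    rho4 v z = quaternionRe z +
      v * quaternionIm z := by
  ext <;> simp [rho4, rhoC] <;> ring

theorem Phi_eq_zero_iff (z : Fin 4 → ℂ) :
    Phi z = 0 ↔
      Quaternion.normSq (quaternionRe z) =
        Quaternion.normSq (quaternionIm z) ∧
      (quaternionRe z * star (quaternionIm z)).re = 0 := by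
  rw [Complex.ext_iff, Quaternion.normSq_def', Quaternion.normSq_def']
  simp only [Phi, sq, Complex.add_re, Complex.add_im, Complex.mul_re, Complex.mul_im,
    Complex.zero_re, Complex.zero_im, Quaternion.re_mul, Quaternion.re_star,
    Quaternion.imI_star, Quaternion.imJ_star, Quaternion.imK_star, re_quaternionRe, imI_quaternionRe, imJ_quaternionRe,
    imK_quaternionRe, re_quaternionIm, imI_quaternionIm, imJ_quaternionIm, imK_quaternionIm]
  constructor <;> rintro ⟨h1, h2⟩ <;> constructor <;> linarith

/-- for the slice-regular function `f` induced by `F` (i.e.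
`f(x+vy) = ρ_v(F(x+ιy))`), a point `x+ιy ∈ 𝒰` carries a zero `f(x+vy) = 0` for some
imaginary unit `v` if and only if `Φ(F(x+ιy)) = 0`. -/
theorem stmt_6 (𝒰 : Set ℂ) (hopen : IsOpen 𝒰)
    (hsym : ∀ z ∈ 𝒰, (starRingEnd ℂ) z ∈ 𝒰)
    (F : ℂ → Fin 4 → ℂ) (hF : DifferentiableOn ℂ F 𝒰)
    (hFsym : ∀ z ∈ 𝒰, F ((starRingEnd ℂ) z) = fun m => (starRingEnd ℂ) (F z m))
    (x y : ℝ) (hxy : (x + y * Complex.I) ∈ 𝒰) :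
    (∃ v : Quaternion ℝ, v ^ 2 = -1 ∧ rho4 v (F (x + y * Complex.I)) = 0) ↔
      Phi (F (x + y * Complex.I)) = 0 := by
  simp only [rho4_eq_add_mul, exists_imaginary_unit_add_mul_eq_zero_iff, Phi_eq_zero_iff]
end
end

section
/- Hurwitz theorem for slice-regular functions: let 𝒰 ⊆ ℂ be open, connected, invariant under complex conjugation, with 𝒰 ∩ ℝ ≠ ∅. Let F_n : 𝒰 → ℂ⁴ (n ∈ ℕ) and F : 𝒰 → ℂ⁴ be holomorphic maps, all satisfying the symmetry H(conj z) = conj(H(z)) componentwise. Assume each induced slice-regular function f_n is nonvanishing, i.e. Φ(F_n(z)) ≠ 0 for all z ∈ 𝒰 (equivalently ρ_v(F_n(z)) ≠ 0 for all v ∈ 𝕊, z ∈ 𝒰), and that f_n → f uniformly, i.e. sup_{z ∈ 𝒰, v ∈ 𝕊} ‖ρ_v(F_n(z)) − ρ_v(F(z))‖ → 0 as n → ∞. Then either F is identically 0 on 𝒰 (so f ≡ 0), or Φ(F(z)) ≠ 0 for every z ∈ 𝒰 (so f is nonvanishing on U). -/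
noncomputable section
open Complex MeasureTheory

open Filter Topology Set Metric

/-- **Hurwitz's theorem**: a locally uniform limit of nonvanishing holomorphic functions on a
preconnected open set is either identically zero or nonvanishing. -/
theorem hurwitz_eqOn_zero_or_forall_ne_zero {ι : Type*} {l : Filter ι} [l.NeBot] {U : Set ℂ}
    (hU : IsOpen U) (hc : IsPreconnected U) {g : ι → ℂ → ℂ} {G : ℂ → ℂ}
    (hg : ∀ n, DifferentiableOn ℂ (g n) U) (hG : DifferentiableOn ℂ G U)
    (hne : ∀ n, ∀ z ∈ U, g n z ≠ 0) (hlim : TendstoLocallyUniformlyOn g G l U) :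
    EqOn G 0 U ∨ ∀ z ∈ U, G z ≠ 0 := by
  rw [or_iff_not_imp_right]
  intro h
  push Not at h
  obtain ⟨z₀, hz₀, hGz₀⟩ := h
  have hGan := hG.analyticOnNhd hU
  rcases (hGan z₀ hz₀).eventually_eq_zero_or_eventually_ne_zero with h0 | h0
  · exact hGan.eqOn_zero_of_preconnected_of_eventuallyEq_zero hc hz₀ h0
  exfalso
  obtain ⟨r, hr, hball⟩ : ∃ r > 0, ∀ z ∈ closedBall z₀ r, z ∈ U ∧ (z ≠ z₀ → G z ≠ 0) :=
    nhds_basis_closedBall.eventually_iff.1 <|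
      Filter.Eventually.and (hU.mem_nhds hz₀) (eventually_nhdsWithin_iff.1 h0)
  have hsub : closedBall z₀ r ⊆ U := fun z hz => (hball z hz).1
  have hsphere : ∀ z ∈ sphere z₀ r, G z ≠ 0 := fun z hz =>
    (hball z (sphere_subset_closedBall hz)).2 (ne_of_mem_sphere hz hr.ne')
  obtain ⟨w, hw, hmin⟩ := (isCompact_sphere z₀ r).exists_isMinOn
    (NormedSpace.sphere_nonempty.2 hr.le)
    ((hG.continuousOn.mono (sphere_subset_closedBall.trans hsub)).norm)
  have hm : 0 < ‖G w‖ := norm_pos_iff.2 (hsphere w hw)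
  have hunif : TendstoUniformlyOn g G l (closedBall z₀ r) :=
    (tendstoLocallyUniformlyOn_iff_forall_isCompact hU).1 hlim _ hsub (isCompact_closedBall z₀ r)
  obtain ⟨n, hn⟩ := (Metric.tendstoUniformlyOn_iff.1 hunif (‖G w‖ / 2) (half_pos hm)).exists
  have hbound : ∀ z ∈ frontier (ball z₀ r), ‖(g n z)⁻¹‖ ≤ (‖G w‖ / 2)⁻¹ := by
    intro z hz
    rw [frontier_ball z₀ hr.ne'] at hz
    have h1 := hn z (sphere_subset_closedBall hz)
    have h2 : ‖G w‖ ≤ ‖G z‖ := hmin hz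
    rw [dist_eq_norm] at h1
    have h3 := norm_sub_norm_le (G z) (g n z)
    rw [norm_inv]
    exact inv_anti₀ (half_pos hm) (by linarith)
  have hdiff : DiffContOnCl ℂ (fun z => (g n z)⁻¹) (ball z₀ r) := by
    apply DifferentiableOn.diffContOnCl
    rw [closure_ball z₀ hr.ne']
    exact ((hg n).mono hsub).fun_inv fun z hz => hne n z (hsub hz)
  have hle := Complex.norm_le_of_forall_mem_frontier_norm_le isBounded_ball hdiff hbound
    (subset_closure (mem_ball_self hr))
  have hlt := hn z₀ (mem_closedBall_self hr.le)
  rw [hGz₀, dist_zero_left] at hlt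
  rw [norm_inv, inv_le_inv₀ (norm_pos_iff.2 (hne n z₀ hz₀)) (half_pos hm)] at hle
  linarith

theorem Quaternion.abs_components_le_norm (q : Quaternion ℝ) :
    |q.re| ≤ ‖q‖ ∧ |q.imI| ≤ ‖q‖ ∧ |q.imJ| ≤ ‖q‖ ∧ |q.imK| ≤ ‖q‖ := by
  have h : ‖q‖ ^ 2 = q.re ^ 2 + q.imI ^ 2 + q.imJ ^ 2 + q.imK ^ 2 := by
    rw [sq, ← Quaternion.normSq_eq_norm_mul_self, Quaternion.normSq_def']
  refine ⟨?_, ?_, ?_, ?_⟩ <;> refine abs_le_of_sq_le_sq ?_ (norm_nonneg q) <;> nlinarith only [h,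
    sq_nonneg q.re, sq_nonneg q.imI, sq_nonneg q.imJ, sq_nonneg q.imK]

theorem qi_components : qi.re = 0 ∧ qi.imI = 1 ∧ qi.imJ = 0 ∧ qi.imK = 0 :=
  ⟨rfl, rfl, rfl, rfl⟩

theorem qj_components : qj.re = 0 ∧ qj.imI = 0 ∧ qj.imJ = 1 ∧ qj.imK = 0 :=
  ⟨rfl, rfl, rfl, rfl⟩

theorem qk_components : qk.re = 0 ∧ qk.imI = 0 ∧ qk.imJ = 0 ∧ qk.imK = 1 :=
  ⟨rfl, rfl, rfl, rfl⟩

theorem qi_sq : qi ^ 2 = -1 := by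
  rw [sq]
  ext <;> simp [qi_components] <;> rfl

theorem rho4_sub (v : Quaternion ℝ) (a b : Fin 4 → ℂ) :
    rho4 v (a - b) = rho4 v a - rho4 v b := by
  ext <;> simp [rho4, rhoC] <;> ring

theorem rho4_qi (z : Fin 4 → ℂ) :
    rho4 qi z = ⟨(z 0).re - (z 1).im, (z 0).im + (z 1).re,
      (z 2).re - (z 3).im, (z 2).im + (z 3).re⟩ := by
  ext <;> simp [rho4, rhoC, qi_components, qj_components, qk_components] <;> ring

theorem rho4_neg_qi (z : Fin 4 → ℂ) :
    rho4 (-qi) z = ⟨(z 0).re + (z 1).im, (z 1).re - (z 0).im,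
      (z 2).re + (z 3).im, (z 3).re - (z 2).im⟩ := by
  ext <;> simp [rho4, rhoC, qi_components, qj_components, qk_components] <;> ring

theorem norm_apply_le_of_rho4_le {z : Fin 4 → ℂ} {ε : ℝ} (h₁ : ‖rho4 qi z‖ ≤ ε)
    (h₂ : ‖rho4 (-qi) z‖ ≤ ε) (m : Fin 4) : ‖z m‖ ≤ 2 * ε := by
  obtain ⟨a0, a1, a2, a3⟩ := Quaternion.abs_components_le_norm (rho4 qi z)
  obtain ⟨b0, b1, b2, b3⟩ := Quaternion.abs_components_le_norm (rho4 (-qi) z)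
  rw [rho4_qi] at a0 a1 a2 a3 h₁
  rw [rho4_neg_qi] at b0 b1 b2 b3 h₂
  simp only [abs_le] at a0 a1 a2 a3 b0 b1 b2 b3
  have key : |(z m).re| ≤ ε ∧ |(z m).im| ≤ ε := by
    simp only [abs_le]
    fin_cases m <;> simp only [Fin.zero_eta, Fin.mk_one, Fin.reduceFinMk] <;>
      refine ⟨⟨?_, ?_⟩, ?_, ?_⟩ <;> linarith
  linarith [Complex.norm_le_abs_re_add_abs_im (z m), key.1, key.2]

theorem Phi_eq_zero_iff_of_real {z : Fin 4 → ℂ} (hz : ∀ m, (starRingEnd ℂ) (z m) = z m) :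
    Phi z = 0 ↔ z = 0 := by
  refine ⟨fun h => ?_, fun h => by simp [h, Phi]⟩
  choose x hx using fun m => Complex.conj_eq_iff_real.1 (hz m)
  have hsum : x 0 ^ 2 + x 1 ^ 2 + x 2 ^ 2 + x 3 ^ 2 = 0 := by
    simp only [Phi, hx] at h
    exact_mod_cast h
  funext m
  have : x m = 0 := by
    rw [← sq_eq_zero_iff]
    fin_cases m <;> simp only [Fin.zero_eta, Fin.mk_one, Fin.reduceFinMk] <;>
      linarith [sq_nonneg (x 0), sq_nonneg (x 1), sq_nonneg (x 2), sq_nonneg (x 3)]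
  simp [hx, this]

theorem DifferentiableOn.Phi_comp {F : ℂ → Fin 4 → ℂ} {U : Set ℂ} (hF : DifferentiableOn ℂ F U) :
    DifferentiableOn ℂ (fun z => Phi (F z)) U := by
  have h := differentiableOn_pi.1 hF
  exact ((((h 0).fun_pow 2).fun_add ((h 1).fun_pow 2)).fun_add ((h 2).fun_pow 2)).fun_add
    ((h 3).fun_pow 2)

theorem TendstoLocallyUniformlyOn.Phi_comp {ι : Type*} {l : Filter ι} {F : ι → ℂ → Fin 4 → ℂ}
    {G : ℂ → Fin 4 → ℂ} {U : Set ℂ} (hG : ContinuousOn G U)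
    (h : ∀ m, TendstoLocallyUniformlyOn (fun n z => F n z m) (fun z => G z m) l U) :
    TendstoLocallyUniformlyOn (fun n z => Phi (F n z)) (fun z => Phi (G z)) l U := by
  have hsq : ∀ m, TendstoLocallyUniformlyOn (fun n z => F n z m ^ 2) (fun z => G z m ^ 2) l U := by
    intro m
    have hm := continuousOn_pi.1 hG m
    simp only [sq]
    exact (h m).mul₀ (h m) hm hm
  exact (((hsq 0).add (hsq 1)).add (hsq 2)).add (hsq 3)

/-- Hurwitz theorem for slice-regular functions: if the induced slice-regular
functions `f_n` are all nonvanishing (`Φ(F_n(z)) ≠ 0` on `𝒰`) and `f_n → f` uniformly, then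
either `F ≡ 0` on `𝒰` or `Φ(F(z)) ≠ 0` for every `z ∈ 𝒰`. -/
theorem stmt_10 (𝒰 : Set ℂ) (hopen : IsOpen 𝒰) (hconn : IsConnected 𝒰)
    (hsym : ∀ z ∈ 𝒰, (starRingEnd ℂ) z ∈ 𝒰)
    (hreal : ∃ x : ℝ, (x : ℂ) ∈ 𝒰)
    (F : ℕ → ℂ → Fin 4 → ℂ) (Flim : ℂ → Fin 4 → ℂ)
    (hFn : ∀ n, DifferentiableOn ℂ (F n) 𝒰)
    (hFlim : DifferentiableOn ℂ Flim 𝒰)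
    (hFnsym : ∀ n, ∀ z ∈ 𝒰, F n ((starRingEnd ℂ) z) = fun m => (starRingEnd ℂ) (F n z m))
    (hFlimsym : ∀ z ∈ 𝒰, Flim ((starRingEnd ℂ) z) = fun m => (starRingEnd ℂ) (Flim z m))
    (hnv : ∀ n, ∀ z ∈ 𝒰, Phi (F n z) ≠ 0)
    (hconv : ∀ ε : ℝ, 0 < ε → ∃ N : ℕ, ∀ n ≥ N, ∀ z ∈ 𝒰, ∀ v : Quaternion ℝ, v ^ 2 = -1 →
      ‖rho4 v (F n z) - rho4 v (Flim z)‖ < ε) :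
    (∀ z ∈ 𝒰, Flim z = 0) ∨ (∀ z ∈ 𝒰, Phi (Flim z) ≠ 0) := by
  have hcomp : ∀ m, TendstoLocallyUniformlyOn (fun n z => F n z m) (fun z => Flim z m) atTop 𝒰 := by
    intro m
    refine (Metric.tendstoUniformlyOn_iff.2 fun ε hε => ?_).tendstoLocallyUniformlyOn
    obtain ⟨N, hN⟩ := hconv (ε / 3) (by positivity)
    filter_upwards [eventually_ge_atTop N] with n hn z hz
    have h₁ := hN n hn z hz qi qi_sq
    have h₂ := hN n hn z hz (-qi) (by rw [neg_sq, qi_sq])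
    rw [← rho4_sub] at h₁ h₂
    have h := norm_apply_le_of_rho4_le h₁.le h₂.le m
    rw [dist_comm, dist_eq_norm]
    rw [Pi.sub_apply] at h
    linarith
  refine (hurwitz_eqOn_zero_or_forall_ne_zero hopen hconn.isPreconnected
    (fun n => (hFn n).Phi_comp) hFlim.Phi_comp hnv
    (TendstoLocallyUniformlyOn.Phi_comp hFlim.continuousOn hcomp)).imp_left fun hzero => ?_
  obtain ⟨x, hx⟩ := hreal
  have htend : Tendsto ((↑) : ℝ → ℂ) (𝓝[≠] x) (𝓝[≠] (x : ℂ)) :=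
    Complex.continuous_ofReal.continuousAt.continuousWithinAt.tendsto_nhdsWithin
      fun t ht => by simpa using ht
  have hev : ∀ᶠ t : ℝ in 𝓝[≠] x, Flim t = 0 := by
    filter_upwards [htend.eventually (nhdsWithin_le_nhds (hopen.mem_nhds hx))] with t ht
    refine (Phi_eq_zero_iff_of_real fun m => ?_).1 (hzero ht)
    have := hFlimsym t ht
    rw [Complex.conj_ofReal] at this
    exact (congrFun this m).symm
  exact (hFlim.analyticOnNhd hopen).eqOn_zero_of_preconnected_of_frequently_eq_zero
    hconn.isPreconnected hx (htend.frequently hev.frequently)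
end
end

section
/- Maximum modulus principle for slice-regular functions: with 𝒰, F and the induced slice-regular function f as in the context, assume moreover that 𝒰 is connected. If there exists q ∈ U such that ‖f(p)‖ ≤ ‖f(q)‖ for all p ∈ U (i.e. ‖f‖ attains its maximum at an interior point), then f is constant on U (equivalently, F is constant on 𝒰). -/
noncomputable section
open Complex MeasureTheory

/-- The quaternion with given real coordinates. -/
def quatOfCoords (w : Fin 4 → ℝ) : Quaternion ℝ := ⟨w 0, w 1, w 2, w 3⟩

@[simp] theorem quatOfCoords_re (w : Fin 4 → ℝ) : (quatOfCoords w).re = w 0 := rfl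

@[simp] theorem quatOfCoords_imI (w : Fin 4 → ℝ) : (quatOfCoords w).imI = w 1 := rfl

@[simp] theorem quatOfCoords_imJ (w : Fin 4 → ℝ) : (quatOfCoords w).imJ = w 2 := rfl

@[simp] theorem quatOfCoords_imK (w : Fin 4 → ℝ) : (quatOfCoords w).imK = w 3 := rfl

theorem quatOfCoords_injective : Function.Injective quatOfCoords := by
  intro w w' h
  rw [Quaternion.ext_iff] at h
  obtain ⟨h0, h1, h2, h3⟩ := h
  funext m
  fin_cases m
  exacts [h0, h1, h2, h3]

theorem quatOfCoords_zero : quatOfCoords 0 = 0 := rfl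

theorem quatOfCoords_neg (w : Fin 4 → ℝ) : quatOfCoords (fun m => -w m) = -quatOfCoords w := by
  apply Quaternion.ext <;> simp

/-- `ρ_v(z) = Re z + v Im z`, with `ℝ⁴` identified with `ℍ`. -/
theorem rho4_eq (v : Quaternion ℝ) (z : Fin 4 → ℂ) :
    rho4 v z = quatOfCoords (fun m => (z m).re) + v * quatOfCoords (fun m => (z m).im) := by
  have hi : qi = quatOfCoords ![0, 1, 0, 0] := rfl
  have hj : qj = quatOfCoords ![0, 0, 1, 0] := rfl
  have hk : qk = quatOfCoords ![0, 0, 0, 1] := rfl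
  apply Quaternion.ext <;> simp [rho4, rhoC, hi, hj, hk] <;> ring

/-- The real functional `⟨ρ_v(·), a⟩` is the real part of a complex-linear functional. -/
theorem exists_re_eq_inner_rho4 (v a : Quaternion ℝ) :
    ∃ c : Fin 4 → ℂ, ∀ z : Fin 4 → ℂ, (∑ m, z m * c m).re = inner ℝ (rho4 v z) a := by
  refine ⟨fun m => ⟨inner ℝ (quatOfCoords (Pi.single m 1)) a,
    -inner ℝ (v * quatOfCoords (Pi.single m 1)) a⟩, fun z => ?_⟩
  simp [Fin.sum_univ_four, rho4_eq, Quaternion.inner_def]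
  ring

/-- If `‖ρ_v ∘ F‖` has a maximum on a connected open set, then `ρ_v ∘ F` is constant there. -/
theorem rho4_comp_eq_of_isMaxOn {U : Set ℂ} (ho : IsOpen U) (hc : IsPreconnected U)
    {F : ℂ → Fin 4 → ℂ} (hF : DifferentiableOn ℂ F U) (v : Quaternion ℝ) {z₀ : ℂ} (hz₀ : z₀ ∈ U)
    (hmax : ∀ z ∈ U, ‖rho4 v (F z)‖ ≤ ‖rho4 v (F z₀)‖) {z : ℂ} (hz : z ∈ U) :
    rho4 v (F z) = rho4 v (F z₀) := by
  set a := rho4 v (F z₀)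
  obtain ⟨c, hc'⟩ := exists_re_eq_inner_rho4 v a
  have hd : DifferentiableOn ℂ (fun w => Complex.exp (∑ m, F w m * c m)) U :=
    (DifferentiableOn.fun_sum fun m _ =>
      ((differentiableOn_pi.1 hF m).mul_const (c m))).cexp
  have haa : inner ℝ a a = ‖a‖ ^ 2 := real_inner_self_eq_norm_sq a
  have hm : IsMaxOn (norm ∘ fun w => Complex.exp (∑ m, F w m * c m)) U z₀ := by
    intro w hw
    simp only [Set.mem_ofPred_eq, Function.comp_apply, Complex.norm_exp, hc', Real.exp_le_exp]
    calc inner ℝ (rho4 v (F w)) a ≤ ‖rho4 v (F w)‖ * ‖a‖ := real_inner_le_norm _ _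
      _ ≤ ‖a‖ * ‖a‖ := by gcongr; exact hmax w hw
      _ = inner ℝ a a := by rw [haa, sq]
  have h := Complex.norm_eqOn_of_isPreconnected_of_isMaxOn hc ho hd hz₀ hm hz
  simp only [Function.comp_apply, Function.const_apply, Complex.norm_exp, hc',
    Real.exp_eq_exp] at h
  have hin : inner ℝ (rho4 v (F z)) a = ‖a‖ ^ 2 := h.trans haa
  have hsq : ‖rho4 v (F z)‖ ^ 2 ≤ ‖a‖ ^ 2 := by gcongr; exact hmax z hz
  have hsub := norm_sub_sq_real (rho4 v (F z)) a
  have : ‖rho4 v (F z) - a‖ ^ 2 = 0 := le_antisymm (by linarith) (sq_nonneg _)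
  exact sub_eq_zero.1 (norm_eq_zero.1 (pow_eq_zero_iff two_ne_zero |>.1 this))

/-- Maximum modulus principle for slice-regular functions: if `𝒰` is connected
and `‖f‖` attains its maximum over `U` at an interior point `q = s + v₀ t`, then `f` is
constant on `U` (equivalently, `F` is constant on `𝒰`). -/
theorem stmt_16 (𝒰 : Set ℂ) (hopen : IsOpen 𝒰) (hconn : IsConnected 𝒰)
    (hsym : ∀ z ∈ 𝒰, (starRingEnd ℂ) z ∈ 𝒰)
    (F : ℂ → Fin 4 → ℂ) (hF : DifferentiableOn ℂ F 𝒰)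
    (hFsym : ∀ z ∈ 𝒰, F ((starRingEnd ℂ) z) = fun m => (starRingEnd ℂ) (F z m))
    (s t : ℝ) (hst : (s + t * Complex.I) ∈ 𝒰)
    (v₀ : Quaternion ℝ) (hv₀ : v₀ ^ 2 = -1)
    (hmax : ∀ (x y : ℝ) (v : Quaternion ℝ), v ^ 2 = -1 → (x + y * Complex.I) ∈ 𝒰 →
      ‖rho4 v (F (x + y * Complex.I))‖ ≤ ‖rho4 v₀ (F (s + t * Complex.I))‖) :
    (∀ z ∈ 𝒰, ∀ z' ∈ 𝒰, F z = F z') ∧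
    ∃ c : Quaternion ℝ, ∀ (x y : ℝ) (v : Quaternion ℝ), v ^ 2 = -1 →
      (x + y * Complex.I) ∈ 𝒰 → rho4 v (F (x + y * Complex.I)) = c := by
  have hcon : ∀ z ∈ 𝒰, rho4 v₀ (F z) = rho4 v₀ (F (s + t * Complex.I)) := fun z hz =>
    rho4_comp_eq_of_isMaxOn hopen hconn.isPreconnected hF v₀ hst
      (fun w hw => by
        have h := hmax w.re w.im v₀ hv₀ (by rwa [Complex.re_add_im])
        rwa [Complex.re_add_im] at h) hz
  set a := rho4 v₀ (F (s + t * Complex.I))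
  have hv_ne : v₀ ≠ 0 := by
    rintro rfl
    simp at hv₀
  have key : ∀ z ∈ 𝒰, (∀ m, (F z m).im = 0) ∧ quatOfCoords (fun m => (F z m).re) = a := by
    intro z hz
    have h₁ := hcon z hz
    have h₂ := hcon _ (hsym z hz)
    rw [hFsym z hz] at h₂
    rw [rho4_eq] at h₁ h₂
    simp only [Complex.conj_re, Complex.conj_im, quatOfCoords_neg, mul_neg] at h₂
    have h₃ : v₀ * quatOfCoords (fun m => (F z m).im) = 0 := by
      have h := eq_neg_iff_add_eq_zero.1 (add_left_cancel (h₁.trans h₂.symm))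
      rw [← two_smul ℝ] at h
      exact (smul_eq_zero.1 h).resolve_left two_ne_zero
    have h₄ := (mul_eq_zero.1 h₃).resolve_left hv_ne
    rw [← quatOfCoords_zero] at h₄
    exact ⟨congrFun (quatOfCoords_injective h₄), by rwa [h₃, add_zero] at h₁⟩
  refine ⟨fun z hz z' hz' => ?_, a, fun x y v _ hxy => ?_⟩
  · obtain ⟨him, hre⟩ := key z hz
    obtain ⟨him', hre'⟩ := key z' hz'
    funext m
    exact Complex.ext (congrFun (quatOfCoords_injective (hre.trans hre'.symm)) m)
      ((him m).trans (him' m).symm)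
  · obtain ⟨him, hre⟩ := key _ hxy
    rw [rho4_eq, hre, funext him]
    exact (congrArg (a + v * ·) quatOfCoords_zero).trans (by simp)
end
end
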